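/- Let P be a polynomial of degree d ≥ 2 with coefficients in K, and let O ⊆ K be a cycle of P with multiplier λ. Suppose λ ≠ 0 and that either (#O ≤ d−1 and |λ| < λ̂(d)^{#O}) or (#O > d−1 and |λ|·λ(d)^{d−1} < λ(d)^{#O}·λ̂(d)^{d−1}). Then there exists c ∈ K with P'(c) = 0 such that the forward orbit of c is infinite (the points P^n(c), n ≥ 0, are pairwise distinct) and the sequence (P^{n·#O}(c))_{n≥1} converges to a point of O. (This is Corollary 1.4 of the paper; the hypothesis is the multiplicative form of −∞ < χ < log λ̂(d), resp. χ < log λ(d) + ((d−1)/#O)·log(λ̂(d)/λ(d)), for the Lyapunov exponent χ = (1/#O) log|λ|.) -/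

import Mathlib

/-!
STATEMENT 3 (Corollary 1.4): Let `P` be a polynomial of degree `d ≥ 2` over `K` and `O`
a cycle of `P` of period `N` with multiplier `λ ≠ 0`.  If either `N ≤ d − 1` and
`‖λ‖ < lamHat K d ^ N`, or `N > d − 1` and
`‖λ‖ · lam K d ^ (d−1) < lam K d ^ N · lamHat K d ^ (d−1)`, then `P` has a critical
point `c` with infinite forward orbit attracted to `O`.
-/

open Polynomial Filter

/-- `lam K d = min {‖(m : K)‖ : m ∈ {1, …, d}}`. -/
noncomputable def lam (K : Type*) [NormedField K] (d : ℕ) : ℝ :=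
  ⨅ m : Finset.Icc 1 d, ‖((m : ℕ) : K)‖

/-- `lamHat K d = min {‖(m : K)‖ ^ m : m ∈ {1, …, d}}`. -/
noncomputable def lamHat (K : Type*) [NormedField K] (d : ℕ) : ℝ :=
  ⨅ m : Finset.Icc 1 d, ‖((m : ℕ) : K)‖ ^ (m : ℕ)

section Aux

variable {K : Type*} [NontriviallyNormedField K]

/-- Gauss norm at radius `r`, computed from the roots. -/
noncomputable def gnr (Q : Polynomial K) (r : ℝ) : ℝ :=
  ‖Q.leadingCoeff‖ * (Q.roots.map (fun b => max r ‖b‖)).prod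

/-- product of the normalised norms of the roots in the open disc of radius `r`. -/
noncomputable def rat (Q : Polynomial K) (r : ℝ) : ℝ :=
  ((Q.roots.filter (fun b => ‖b‖ < r)).map (fun b => ‖b‖ / r)).prod

lemma gnr_nonneg (Q : Polynomial K) (r : ℝ) : 0 ≤ gnr Q r := by
  unfold gnr
  apply mul_nonneg (norm_nonneg _)
  apply Multiset.prod_nonneg
  intro a ha
  obtain ⟨b, -, rfl⟩ := Multiset.mem_map.1 ha
  exact le_max_of_le_right (norm_nonneg _)

lemma gnr_pos {Q : Polynomial K} (hQ : Q ≠ 0) {r : ℝ} (hr : 0 < r) : 0 < gnr Q r := by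
  unfold gnr
  apply mul_pos (norm_pos_iff.2 (leadingCoeff_ne_zero.2 hQ))
  apply Multiset.prod_pos
  intro a ha
  obtain ⟨b, -, rfl⟩ := Multiset.mem_map.1 ha
  exact lt_max_of_lt_left hr

lemma gnr_mono (Q : Polynomial K) : Monotone (gnr Q) := by
  intro r s h
  unfold gnr
  apply mul_le_mul_of_nonneg_left _ (norm_nonneg _)
  apply Multiset.prod_map_le_prod_map₀
  · intro b _
    exact le_max_of_le_right (norm_nonneg _)
  · intro b _
    exact max_le_max h le_rfl

lemma gnr_cont (Q : Polynomial K) : Continuous (gnr Q) := by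
  unfold gnr
  refine continuous_const.mul (continuous_multiset_prod _ ?_)
  intro i _
  fun_prop

lemma norm_mprod (s : Multiset K) (f : K → K) :
    ‖(s.map f).prod‖ = (s.map (fun b => ‖f b‖)).prod := by
  induction s using Multiset.induction_on with
  | empty => simp
  | cons a s ih => simp [ih]

lemma gnr_zero [IsAlgClosed K] (Q : Polynomial K) : gnr Q 0 = ‖Q.eval 0‖ := by
  rw [(IsAlgClosed.splits Q).eval_eq_prod_roots, norm_mul]
  unfold gnr
  congr 1
  rw [norm_mprod]
  congr 1
  apply Multiset.map_congr rfl
  intro b _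
  simp

lemma eval_le_gnr [IsAlgClosed K] [IsUltrametricDist K] (Q : Polynomial K) (w : K) :
    ‖Q.eval w‖ ≤ gnr Q ‖w‖ := by
  rw [(IsAlgClosed.splits Q).eval_eq_prod_roots, norm_mul]
  unfold gnr
  apply mul_le_mul_of_nonneg_left _ (norm_nonneg _)
  rw [norm_mprod]
  apply Multiset.prod_map_le_prod_map₀
  · intro b _
    exact norm_nonneg _
  · intro b _
    change ‖w - b‖ ≤ _
    rw [sub_eq_add_neg]
    simpa using IsUltrametricDist.norm_add_le_max w (-b)

lemma gnr_zero_rat (Q : Polynomial K) {r : ℝ} (hr : 0 < r) :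
    gnr Q 0 = gnr Q r * rat Q r := by
  unfold gnr rat
  rw [mul_assoc]
  congr 1
  induction Q.roots using Multiset.induction_on with
  | empty => simp
  | cons a s ih =>
    rw [Multiset.map_cons, Multiset.prod_cons, ih, Multiset.map_cons, Multiset.prod_cons]
    have h0 : max 0 ‖a‖ = ‖a‖ := max_eq_right (norm_nonneg _)
    rw [h0]
    by_cases h : ‖a‖ < r
    · rw [Multiset.filter_cons_of_pos (p := fun b : K => ‖b‖ < r) _ h, Multiset.map_cons, Multiset.prod_cons,
        max_eq_left h.le]
      field_simp
    · rw [Multiset.filter_cons_of_neg (p := fun b : K => ‖b‖ < r) _ h, max_eq_right (not_lt.1 h)]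
      ring

lemma coeff_prod [IsUltrametricDist K] (a : K) (s : Multiset K) {r : ℝ} (hr : 0 < r) (ha : a ≠ 0) :
    (∀ j, ‖(C a * (s.map (fun b => X - C b)).prod).coeff j‖ * r ^ j ≤
      ‖a‖ * (s.map (fun b => max r ‖b‖)).prod) ∧
    (∀ j < Multiset.card (s.filter (fun b => ‖b‖ < r)),
      ‖(C a * (s.map (fun b => X - C b)).prod).coeff j‖ * r ^ j <
      ‖a‖ * (s.map (fun b => max r ‖b‖)).prod) ∧
    ‖(C a * (s.map (fun b => X - C b)).prod).coeff (Multiset.card (s.filter (fun b => ‖b‖ < r)))‖ *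
      r ^ (Multiset.card (s.filter (fun b => ‖b‖ < r))) =
      ‖a‖ * (s.map (fun b => max r ‖b‖)).prod := by
  induction s using Multiset.induction_on with
  | empty =>
    refine ⟨?_, ?_, ?_⟩
    · intro j
      rcases j with _ | j
      · simp
      · simp
    · simp
    · simp
  | cons b s ih =>
    obtain ⟨h1, h2, h3⟩ := ih
    set F := C a * (s.map (fun b => X - C b)).prod with hF
    set M := ‖a‖ * (s.map (fun b => max r ‖b‖)).prod with hM
    have hMpos : 0 < M := by
      apply mul_pos (norm_pos_iff.2 ha)
      apply Multiset.prod_pos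
      intro x hx
      obtain ⟨b, -, rfl⟩ := Multiset.mem_map.1 hx
      exact lt_max_of_lt_left hr
    have e1 : C a * ((b ::ₘ s).map (fun b => X - C b)).prod = F * (X - C b) := by
      rw [Multiset.map_cons, Multiset.prod_cons, hF]; ring
    have e2 : ‖a‖ * ((b ::ₘ s).map (fun b => max r ‖b‖)).prod = M * max r ‖b‖ := by
      rw [Multiset.map_cons, Multiset.prod_cons, hM]; ring
    rw [e1, e2]
    have c0 : (F * (X - C b)).coeff 0 = - (F.coeff 0 * b) := by
      simp [mul_sub]
    have cs : ∀ j, (F * (X - C b)).coeff (j+1) = F.coeff j + - (F.coeff (j+1) * b) := by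
      intro j
      rw [mul_sub, coeff_sub, coeff_mul_X, coeff_mul_C]; ring
    have hb0 := norm_nonneg b
    have key : ∀ j, ‖(F * (X - C b)).coeff (j+1)‖ * r ^ (j+1) ≤
        max (‖F.coeff j‖ * r ^ j * r) (‖F.coeff (j+1)‖ * r ^ (j+1) * ‖b‖) := by
      intro j
      rw [cs j]
      have := IsUltrametricDist.norm_add_le_max (F.coeff j) (-(F.coeff (j+1) * b))
      calc _ ≤ max ‖F.coeff j‖ ‖-(F.coeff (j+1) * b)‖ * r ^ (j+1) := by gcongr
        _ = _ := by
          rw [max_mul_of_nonneg _ _ (by positivity), norm_neg, norm_mul]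
          congr 1 <;> ring
    have key0 : ‖(F * (X - C b)).coeff 0‖ * r ^ 0 = ‖F.coeff 0‖ * r ^ 0 * ‖b‖ := by
      rw [c0, norm_neg, norm_mul]; ring
    by_cases hb : ‖b‖ < r
    · rw [Multiset.filter_cons_of_pos (p := fun b : K => ‖b‖ < r) _ hb, max_eq_left hb.le, Multiset.card_cons]
      set m := Multiset.card (s.filter (fun b => ‖b‖ < r))
      have hs : ∀ j, ‖F.coeff j‖ * r ^ j * ‖b‖ < M * r := fun j =>
        (mul_le_mul_of_nonneg_right (h1 j) hb0).trans_lt (mul_lt_mul_of_pos_left hb hMpos)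
      refine ⟨?_, ?_, ?_⟩
      · rintro (_ | j)
        · rw [key0]; exact (hs 0).le
        · refine (key j).trans (max_le ?_ (hs _).le)
          exact mul_le_mul_of_nonneg_right (h1 j) hr.le
      · rintro (_ | j) hj
        · rw [key0]; exact hs 0
        · refine (key j).trans_lt (max_lt ?_ (hs _))
          exact mul_lt_mul_of_pos_right (h2 j (by omega)) hr
      · have hlt : ‖-(F.coeff (m+1) * b)‖ < ‖F.coeff m‖ := by
          have := hs (m+1)
          rw [← h3] at this
          rw [norm_neg, norm_mul]
          have h5 : ‖F.coeff (m+1)‖ * ‖b‖ * r^(m+1) < ‖F.coeff m‖ * r^(m+1) := by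
            rw [pow_succ] at this ⊢; nlinarith
          exact lt_of_mul_lt_mul_right h5 (by positivity)
        rw [cs m, IsUltrametricDist.norm_add_eq_max_of_norm_ne_norm hlt.ne', max_eq_left hlt.le,
          ← h3]
        ring
    · have hb' := not_lt.1 hb
      rw [Multiset.filter_cons_of_neg (p := fun b : K => ‖b‖ < r) _ hb, max_eq_right hb']
      set m := Multiset.card (s.filter (fun b => ‖b‖ < r))
      have hbpos : 0 < ‖b‖ := hr.trans_le hb'
      refine ⟨?_, ?_, ?_⟩
      · rintro (_ | j)
        · rw [key0]; exact mul_le_mul_of_nonneg_right (h1 0) hb0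
        · refine (key j).trans (max_le ?_ ?_)
          · exact mul_le_mul (h1 j) hb' hr.le hMpos.le
          · exact mul_le_mul_of_nonneg_right (h1 _) hb0
      · rintro (_ | j) hj
        · rw [key0]; exact mul_lt_mul_of_pos_right (h2 0 hj) hbpos
        · refine (key j).trans_lt (max_lt ?_ ?_)
          · exact mul_lt_mul (h2 j (by omega)) hb' hr hMpos.le
          · exact mul_lt_mul_of_pos_right (h2 _ hj) hbpos
      · rcases hm : m with _ | j
        · rw [key0, ← hm, h3]
        · rw [hm] at h2 h3
          have h6 : ‖F.coeff j‖ * r ^ (j+1) < ‖F.coeff (j+1)‖ * ‖b‖ * r ^ (j+1) := by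
            have := mul_lt_mul (h2 j (by omega)) hb' hr hMpos.le
            rw [← h3] at this
            calc _ = ‖F.coeff j‖ * r ^ j * r := by ring
              _ < _ := this
              _ = _ := by ring
          have h7 : ‖F.coeff j‖ < ‖-(F.coeff (j+1) * b)‖ := by
            rw [norm_neg, norm_mul]
            exact lt_of_mul_lt_mul_right h6 (by positivity)
          rw [cs j, IsUltrametricDist.norm_add_eq_max_of_norm_ne_norm h7.ne, max_eq_right h7.le,
            ← h3, norm_neg, norm_mul]
          ring

lemma coeff_le_gnr [IsAlgClosed K] [IsUltrametricDist K] {Q : Polynomial K} (hQ : Q ≠ 0) {r : ℝ} (hr : 0 < r)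
    (j : ℕ) : ‖Q.coeff j‖ * r ^ j ≤ gnr Q r := by
  have := (coeff_prod Q.leadingCoeff Q.roots hr (leadingCoeff_ne_zero.2 hQ)).1 j
  rw [← (IsAlgClosed.splits Q).eq_prod_roots] at this
  exact this

/-- number of roots in the open disc -/
noncomputable def dg (Q : Polynomial K) (r : ℝ) : ℕ :=
  Multiset.card (Q.roots.filter (fun b => ‖b‖ < r))

lemma coeff_dg [IsAlgClosed K] [IsUltrametricDist K] {Q : Polynomial K} (hQ : Q ≠ 0) {r : ℝ} (hr : 0 < r) :
    ‖Q.coeff (dg Q r)‖ * r ^ (dg Q r) = gnr Q r := by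
  have := (coeff_prod Q.leadingCoeff Q.roots hr (leadingCoeff_ne_zero.2 hQ)).2.2
  rw [← (IsAlgClosed.splits Q).eq_prod_roots] at this
  exact this

end Aux
section Aux2

variable {K : Type*} [NontriviallyNormedField K]

lemma q_fac {Q : Polynomial K} (h0 : Q.eval 0 = 0) : Q = Q.divX * X := by
  have := divX_mul_X_add Q
  rw [coeff_zero_eq_eval_zero, h0] at this
  simpa using this.symm

lemma q_der {Q : Polynomial K} (h0 : Q.eval 0 = 0) :
    Q.derivative.eval 0 = Q.divX.eval 0 := by
  conv_lhs => rw [q_fac h0]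
  simp

lemma q_ne {Q : Polynomial K} (h1 : Q.derivative.eval 0 ≠ 0) : Q ≠ 0 := by
  rintro rfl; simp at h1

lemma q_divne {Q : Polynomial K} (h0 : Q.eval 0 = 0) (h1 : Q.derivative.eval 0 ≠ 0) :
    Q.divX ≠ 0 := by
  intro h; rw [q_der h0, h] at h1; simp at h1

lemma q_roots {Q : Polynomial K} (h0 : Q.eval 0 = 0) (h1 : Q.derivative.eval 0 ≠ 0) :
    Q.roots = 0 ::ₘ Q.divX.roots := by
  conv_lhs => rw [q_fac h0]
  rw [roots_mul, roots_X, add_comm]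
  · rfl
  · rw [← q_fac h0]; exact q_ne h1

lemma q_gnr {Q : Polynomial K} (h0 : Q.eval 0 = 0) (h1 : Q.derivative.eval 0 ≠ 0) {r : ℝ}
    (hr : 0 ≤ r) : gnr Q r = r * gnr Q.divX r := by
  unfold gnr
  rw [q_roots h0 h1, Multiset.map_cons, Multiset.prod_cons]
  have : Q.leadingCoeff = Q.divX.leadingCoeff := by
    conv_lhs => rw [q_fac h0]
    simp
  rw [this, norm_zero, max_eq_left hr]
  ring

lemma q_gnr0 {Q : Polynomial K} (h0 : Q.eval 0 = 0) (h1 : Q.derivative.eval 0 ≠ 0) :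
    gnr Q 0 = 0 := by
  rw [q_gnr h0 h1 le_rfl, zero_mul]

lemma q_gnr_ratio {Q : Polynomial K} (h0 : Q.eval 0 = 0) (h1 : Q.derivative.eval 0 ≠ 0) {s r : ℝ}
    (hs : 0 ≤ s) (hsr : s ≤ r) : gnr Q s * r ≤ gnr Q r * s := by
  rw [q_gnr h0 h1 hs, q_gnr h0 h1 (hs.trans hsr)]
  have := gnr_mono Q.divX hsr
  have h2 : 0 ≤ s * r := mul_nonneg hs (hs.trans hsr)
  nlinarith

lemma q_gnr_div0 [IsAlgClosed K] {Q : Polynomial K} (h0 : Q.eval 0 = 0) :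
    gnr Q.divX 0 = ‖Q.derivative.eval 0‖ := by
  rw [gnr_zero, q_der h0]

lemma q_gnr_strict [IsAlgClosed K] {Q : Polynomial K} (h0 : Q.eval 0 = 0)
    (h1 : Q.derivative.eval 0 ≠ 0) {s r : ℝ}
    (hs : 0 ≤ s) (hsr : s < r) : gnr Q s < gnr Q r := by
  rw [q_gnr h0 h1 hs, q_gnr h0 h1 (hs.trans hsr.le)]
  have := gnr_mono Q.divX hsr.le
  have h2 : 0 < gnr Q.divX r := gnr_pos (q_divne h0 h1) (hs.trans_lt hsr)
  nlinarith

/-- inverse of the Gauss norm function -/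
lemma q_inv [IsAlgClosed K] {Q : Polynomial K} (h0 : Q.eval 0 = 0)
    (h1 : Q.derivative.eval 0 ≠ 0) {s y : ℝ} (hs : 0 ≤ s) (hy : gnr Q s ≤ y) :
    ∃ r, s ≤ r ∧ gnr Q r = y := by
  have hl : 0 < ‖Q.derivative.eval 0‖ := norm_pos_iff.2 h1
  set t := max s (y / ‖Q.derivative.eval 0‖) with ht
  have hst : s ≤ t := le_max_left _ _
  have hyt : y ≤ gnr Q t := by
    rw [q_gnr h0 h1 (hs.trans hst)]
    have h3 := gnr_mono Q.divX (hs.trans hst)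
    rw [q_gnr_div0 h0] at h3
    have h4 : y / ‖Q.derivative.eval 0‖ ≤ t := le_max_right _ _
    rw [div_le_iff₀ hl] at h4
    exact h4.trans (mul_le_mul_of_nonneg_left h3 (hs.trans hst))
  obtain ⟨r, hr, hr2⟩ := intermediate_value_Icc hst (gnr_cont Q).continuousOn ⟨hy, hyt⟩
  exact ⟨r, hr.1, hr2⟩

lemma q_dg {Q : Polynomial K} (h0 : Q.eval 0 = 0) (h1 : Q.derivative.eval 0 ≠ 0) {r : ℝ}
    (hr : 0 < r) : dg Q r = dg Q.divX r + 1 := by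
  unfold dg
  rw [q_roots h0 h1, Multiset.filter_cons_of_pos (p := fun b : K => ‖b‖ < r) _ (by simpa using hr),
    Multiset.card_cons]

lemma dg_le (Q : Polynomial K) (r : ℝ) : dg Q r ≤ Q.natDegree :=
  (Multiset.card_le_card (Multiset.filter_le _ _)).trans (card_roots' Q)

lemma q_U0 [IsAlgClosed K] [IsUltrametricDist K] {Q : Polynomial K} (h0 : Q.eval 0 = 0)
    (h1 : Q.derivative.eval 0 ≠ 0) {r : ℝ} (hr : 0 < r) :
    ‖((dg Q r : ℕ) : K)‖ * gnr Q r ≤ gnr Q.derivative r * r := by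
  have hd : Q.derivative ≠ 0 := by intro h; rw [h] at h1; simp at h1
  rw [← coeff_dg (q_ne h1) hr]
  rw [q_dg h0 h1 hr]
  set k := dg Q.divX r
  have := coeff_le_gnr hd hr k
  rw [coeff_derivative] at this
  have h2 := mul_le_mul_of_nonneg_right this hr.le
  refine le_trans (le_of_eq ?_) h2
  rw [norm_mul]; push_cast; ring

lemma rat_of_empty {Q : Polynomial K} {r : ℝ} (h : ∀ c, Q ≠ 0 → Q.eval c = 0 → r ≤ ‖c‖) :
    rat Q r = 1 := by
  unfold rat
  rw [Multiset.filter_eq_nil.2]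
  · simp
  · intro a ha
    have := mem_roots'.1 ha
    exact not_lt.2 (h a this.1 this.2)

lemma rat_le_of_mem {Q : Polynomial K} {r : ℝ} (hr : 0 < r) {b : K} (hb : b ∈ Q.roots)
    (hbr : ‖b‖ < r) : rat Q r ≤ ‖b‖ / r := by
  unfold rat
  have hm : b ∈ Q.roots.filter (fun b => ‖b‖ < r) := Multiset.mem_filter.2 ⟨hb, hbr⟩
  obtain ⟨t, ht⟩ := Multiset.exists_cons_of_mem hm
  rw [ht, Multiset.map_cons, Multiset.prod_cons]
  apply mul_le_of_le_one_right (by positivity)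
  have : (t.map (fun b => ‖b‖ / r)).prod ≤ (t.map (fun _ => (1:ℝ))).prod := by
    apply Multiset.prod_map_le_prod_map₀
    · intro i _; positivity
    · intro i hi
      have : i ∈ Q.roots.filter (fun b => ‖b‖ < r) := by rw [ht]; exact Multiset.mem_cons_of_mem hi
      rw [div_le_one hr]
      exact (Multiset.mem_filter.1 this).2.le
  simpa using this

/-- no critical point in the open disc -/
lemma q_U [IsAlgClosed K] [IsUltrametricDist K] {Q : Polynomial K} (h0 : Q.eval 0 = 0)
    (h1 : Q.derivative.eval 0 ≠ 0) {r l : ℝ} (hr : 0 < r)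
    (hl : ∀ m : ℕ, 1 ≤ m → m ≤ Q.natDegree → l ≤ ‖(m : K)‖)
    (hc : ∀ c, Q.derivative.eval c = 0 → r ≤ ‖c‖) :
    l * gnr Q r ≤ ‖Q.derivative.eval 0‖ * r := by
  have h2 : gnr Q.derivative r = ‖Q.derivative.eval 0‖ := by
    have := gnr_zero_rat Q.derivative hr
    rw [rat_of_empty (fun c _ h => hc c h), gnr_zero, mul_one] at this
    exact this.symm
  have h3 := q_U0 h0 h1 hr
  rw [h2] at h3
  refine le_trans (mul_le_mul_of_nonneg_right (hl _ ?_ (dg_le Q r)) (gnr_nonneg _ _)) h3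
  rw [q_dg h0 h1 hr]; omega

/-- roots are far away -/
lemma q_W [IsAlgClosed K] [IsUltrametricDist K] {Q : Polynomial K} (h0 : Q.eval 0 = 0)
    (h1 : Q.derivative.eval 0 ≠ 0) {r l : ℝ} (hr : 0 < r)
    (hl : ∀ m : ℕ, 1 ≤ m → m ≤ Q.natDegree → l ≤ ‖(m : K)‖)
    (hl1 : l ≤ 1)
    (hc : ∀ c, Q.derivative.eval c = 0 → r ≤ ‖c‖) {b : K} (hb : Q.eval b = 0) (hb0 : b ≠ 0) :
    l * r ≤ ‖b‖ := by
  by_cases hbr : ‖b‖ < r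
  · have h2 := q_U h0 h1 hr hl hc
    have hmem : b ∈ Q.divX.roots := by
      rw [mem_roots (q_divne h0 h1)]
      have h3 := hb
      rw [q_fac h0] at h3
      simpa [hb0] using h3
    have h3 := rat_le_of_mem hr hmem hbr
    have h4 := gnr_zero_rat Q.divX hr
    rw [q_gnr_div0 h0] at h4
    rw [q_gnr h0 h1 hr.le, h4] at h2
    have h5 : 0 < gnr Q.divX r := gnr_pos (q_divne h0 h1) hr
    have h6 : l ≤ rat Q.divX r := by
      have h7 : 0 < r * gnr Q.divX r := by positivity
      refine le_of_mul_le_mul_right ?_ h7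
      linarith
    have := h6.trans h3
    rwa [le_div_iff₀ hr] at this
  · have := not_lt.1 hbr
    nlinarith

/-- isometric scaling where there are no other roots -/
lemma q_lin [IsAlgClosed K] [IsUltrametricDist K] {Q : Polynomial K} (h0 : Q.eval 0 = 0)
    (h1 : Q.derivative.eval 0 ≠ 0) {r : ℝ}
    (hc : ∀ b, Q.eval b = 0 → b ≠ 0 → r ≤ ‖b‖) {w : K} (hw : ‖w‖ < r) :
    ‖Q.eval w‖ = ‖Q.derivative.eval 0‖ * ‖w‖ := by
  rw [q_der h0]
  conv_lhs => rw [q_fac h0]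
  rw [eval_mul, eval_X, norm_mul]
  congr 1
  rw [(IsAlgClosed.splits Q.divX).eval_eq_prod_roots, (IsAlgClosed.splits Q.divX).eval_eq_prod_roots,
    norm_mul, norm_mul, norm_mprod, norm_mprod]
  congr 2
  apply Multiset.map_congr rfl
  intro b hb
  have hbr : eval b Q.divX = 0 := (mem_roots (q_divne h0 h1)).1 hb
  have hb0 : b ≠ 0 := by
    rintro rfl; exact h1 (by rw [q_der h0]; exact hbr)
  have : r ≤ ‖b‖ := hc b (by rw [q_fac h0, eval_mul, hbr, zero_mul]) hb0
  have h3 : ‖w‖ < ‖-b‖ := by rw [norm_neg]; linarith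
  rw [sub_eq_add_neg, IsUltrametricDist.norm_add_eq_max_of_norm_ne_norm h3.ne, max_eq_right h3.le]
  simp

lemma q_lin' [IsAlgClosed K] {Q : Polynomial K} (h0 : Q.eval 0 = 0)
    (h1 : Q.derivative.eval 0 ≠ 0) {r : ℝ} (hr : 0 ≤ r)
    (hc : ∀ b, Q.eval b = 0 → b ≠ 0 → r ≤ ‖b‖) :
    gnr Q r = ‖Q.derivative.eval 0‖ * r := by
  rcases hr.eq_or_lt with rfl | hr
  · rw [q_gnr0 h0 h1, mul_zero]
  have := gnr_zero_rat Q.divX hr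
  rw [rat_of_empty, q_gnr_div0 h0, mul_one] at this
  · rw [q_gnr h0 h1 hr.le, this, mul_comm]
  · intro b _ hb
    have hb0 : b ≠ 0 := by
      rintro rfl; exact h1 (by rw [q_der h0]; exact hb)
    exact hc b (by rw [q_fac h0, eval_mul, hb, zero_mul]) hb0

/-- one fibre lemma -/
lemma q_F [IsAlgClosed K] [IsUltrametricDist K] {Q : Polynomial K} (h0 : Q.eval 0 = 0)
    (h1 : Q.derivative.eval 0 ≠ 0) {r l : ℝ} (hr : 0 < r)
    (hl0 : ∀ m : ℕ, 1 ≤ m → m ≤ Q.natDegree → (m : K) ≠ 0)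
    (hl : ∀ m : ℕ, 1 ≤ m → m ≤ Q.natDegree → l ≤ ‖(m : K)‖ ^ m)
    (hc : ∀ c, Q.derivative.eval c = 0 → ‖c‖ < r → Q.eval c = 0) {b : K} (hb : Q.eval b = 0)
    (hb0 : b ≠ 0) (hbr : ‖b‖ < r) :
    l * gnr Q r ≤ ‖Q.derivative.eval 0‖ * ‖b‖ := by
  classical
  have hQ := q_ne h1
  have hH := q_divne h0 h1
  have hd : Q.derivative ≠ 0 := by intro h; rw [h] at h1; simp at h1
  have hgH : 0 < gnr Q.divX r := gnr_pos hH hr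
  have hkd := q_dg h0 h1 hr
  set k := dg Q r with hk
  have hk1 : 1 ≤ k := by omega
  have hkn : k ≤ Q.natDegree := dg_le Q r
  set S := Q.divX.roots.filter (fun b => ‖b‖ < r) with hS
  set S' := Q.derivative.roots.filter (fun b => ‖b‖ < r) with hS'
  set x : K → ℝ := fun b => ‖b‖ / r with hx
  have hx0 : ∀ b, 0 ≤ x b := fun b => by positivity
  have hcardS : Multiset.card S = k - 1 := by
    have : dg Q.divX r = Multiset.card S := rfl
    omega
  -- multiplicities
  have hle : S' + S.dedup ≤ S := by
    rw [Multiset.le_iff_count]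
    intro c
    rw [Multiset.count_add]
    by_cases hcS : c ∈ S
    · have hcm := (Multiset.mem_filter.1 hcS)
      have hcr := hcm.2
      have hcH : eval c Q.divX = 0 := (mem_roots hH).1 hcm.1
      have hc0 : c ≠ 0 := by
        rintro rfl; exact h1 (by rw [q_der h0]; exact hcH)
      have hcQ : Q.eval c = 0 := by rw [q_fac h0, eval_mul, hcH, zero_mul]
      have e1 : Multiset.count c S = rootMultiplicity c Q := by
        rw [hS, Multiset.count_filter_of_pos (p := fun b : K => ‖b‖ < r) hcr, ← count_roots,
          q_roots h0 h1, Multiset.count_cons_of_ne hc0]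
      have e2 : Multiset.count c S' = rootMultiplicity c Q.derivative := by
        rw [hS', Multiset.count_filter_of_pos (p := fun b : K => ‖b‖ < r) hcr, ← count_roots]
      have e4 : 1 ≤ rootMultiplicity c Q := (rootMultiplicity_pos hQ).2 hcQ
      have e5 : rootMultiplicity c Q ≤ Q.natDegree := by
        rw [← count_roots]; exact (Multiset.count_le_card _ _).trans (card_roots' Q)
      have e3 := derivative_rootMultiplicity_of_root_of_mem_nonZeroDivisors (p := Q) (t := c) hcQ
        (mem_nonZeroDivisors_of_ne_zero (hl0 _ e4 e5))
      have e6 : Multiset.count c S.dedup = 1 := by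
        rw [Multiset.count_dedup, if_pos hcS]
      omega
    · have e6 : Multiset.count c S.dedup = 0 := by
        rw [Multiset.count_dedup, if_neg hcS]
      have e7 : c ∉ S' := by
        intro h
        have hm := Multiset.mem_filter.1 h
        have hcd : Q.derivative.eval c = 0 := (mem_roots hd).1 hm.1
        have hcQ := hc c hcd hm.2
        have hc0 : c ≠ 0 := by rintro rfl; exact h1 hcd
        apply hcS
        refine Multiset.mem_filter.2 ⟨?_, hm.2⟩
        have : c ∈ Q.roots := (mem_roots hQ).2 hcQ
        rw [q_roots h0 h1] at this
        exact (Multiset.mem_cons.1 this).resolve_left hc0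
      rw [Multiset.count_eq_zero_of_notMem e7, e6]
      exact Nat.zero_le _
  have hxS : ∀ b ∈ S, x b ≤ 1 := by
    intro b hb
    rw [hx]
    exact (div_le_one hr).2 (Multiset.mem_filter.1 hb).2.le
  have hxS0 : ∀ b ∈ S, 0 < x b := by
    intro b hb
    have hcm := (Multiset.mem_filter.1 hb)
    have hcH : eval b Q.divX = 0 := (mem_roots hH).1 hcm.1
    have hc0 : b ≠ 0 := by
      rintro rfl; exact h1 (by rw [q_der h0]; exact hcH)
    exact div_pos (norm_pos_iff.2 hc0) hr
  have hone : ∀ T : Multiset K, T ≤ S → (T.map x).prod ≤ 1 := by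
    intro T hT
    have : (T.map x).prod ≤ (T.map (fun _ => (1:ℝ))).prod := by
      apply Multiset.prod_map_le_prod_map₀
      · intro i _; exact hx0 i
      · intro i hi; exact hxS i (Multiset.mem_of_le hT hi)
    simpa using this
  have hpos : ∀ T : Multiset K, T ≤ S → 0 < (T.map x).prod := by
    intro T hT
    apply Multiset.prod_pos
    intro a ha
    obtain ⟨b, hb, rfl⟩ := Multiset.mem_map.1 ha
    exact hxS0 b (Multiset.mem_of_le hT hb)
  have hS'le : S' ≤ S := le_trans (Multiset.le_add_right _ _) hle
  have hprod : (S.map x).prod ≤ (S'.map x).prod * (S.dedup.map x).prod := by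
    obtain ⟨T, hT⟩ := Multiset.le_iff_exists_add.1 hle
    have hTS : T ≤ S := by rw [hT]; exact Multiset.le_add_left _ _
    have : (S.map x).prod = (S'.map x).prod * (S.dedup.map x).prod * (T.map x).prod := by
      conv_lhs => rw [hT]
      simp
    rw [this]
    apply mul_le_of_le_one_right _ (hone T hTS)
    exact mul_nonneg (hpos _ hS'le).le (hpos _ (Multiset.dedup_le _)).le
  -- Gauss norms
  have g1 : ‖Q.derivative.eval 0‖ = gnr Q.divX r * (S.map x).prod := by
    rw [← q_gnr_div0 h0]; exact gnr_zero_rat Q.divX hr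
  have g2 : ‖Q.derivative.eval 0‖ = gnr Q.derivative r * (S'.map x).prod := by
    rw [← gnr_zero]; exact gnr_zero_rat Q.derivative hr
  have g3 : ‖(k : K)‖ * gnr Q.divX r ≤ gnr Q.derivative r := by
    have := q_U0 h0 h1 hr
    rw [q_gnr h0 h1 hr.le] at this
    refine le_of_mul_le_mul_right ?_ hr
    linarith
  have hD : ‖(k : K)‖ ≤ (S.dedup.map x).prod := by
    have a1 : ‖(k : K)‖ * gnr Q.divX r * (S'.map x).prod ≤
        gnr Q.divX r * ((S'.map x).prod * (S.dedup.map x).prod) := by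
      calc _ ≤ gnr Q.derivative r * (S'.map x).prod :=
            mul_le_mul_of_nonneg_right g3 (hpos _ hS'le).le
        _ = gnr Q.divX r * (S.map x).prod := by rw [← g2, g1]
        _ ≤ _ := mul_le_mul_of_nonneg_left hprod hgH.le
    have a2 : 0 < gnr Q.divX r * (S'.map x).prod := mul_pos hgH (hpos _ hS'le)
    refine le_of_mul_le_mul_right ?_ a2
    linarith
  have hbS : b ∈ S := by
    refine Multiset.mem_filter.2 ⟨?_, hbr⟩
    have : b ∈ Q.roots := (mem_roots hQ).2 hb
    rw [q_roots h0 h1] at this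
    exact (Multiset.mem_cons.1 this).resolve_left hb0
  have hbk : ‖(k : K)‖ ≤ x b := by
    refine hD.trans ?_
    obtain ⟨t, ht⟩ := Multiset.exists_cons_of_mem (Multiset.mem_dedup.2 hbS)
    rw [ht, Multiset.map_cons, Multiset.prod_cons]
    apply mul_le_of_le_one_right (hx0 b)
    apply hone
    exact le_trans (Multiset.le_cons_self _ _) (ht ▸ Multiset.dedup_le S)
  have hpow : ‖(k : K)‖ ^ (k - 1) ≤ (S.map x).prod := by
    calc _ ≤ (S.dedup.map x).prod ^ (k - 1) := pow_le_pow_left₀ (norm_nonneg _) hD _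
      _ = ∏ m ∈ S.toFinset, x m ^ (k - 1) := by
        rw [Finset.prod_pow]; rfl
      _ ≤ ∏ m ∈ S.toFinset, x m ^ Multiset.count m S := by
        apply Finset.prod_le_prod
        · intro i _; exact pow_nonneg (hx0 i) _
        · intro i hi
          apply pow_le_pow_of_le_one (hx0 i) (hxS i (Multiset.mem_toFinset.1 hi))
          rw [← hcardS]; exact Multiset.count_le_card _ _
      _ = _ := (Finset.prod_multiset_map_count S x).symm
  have hfin : ‖(k : K)‖ ^ k ≤ (S.map x).prod * x b := by
    calc ‖(k : K)‖ ^ k = ‖(k : K)‖ ^ (k - 1) * ‖(k : K)‖ := by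
          rw [← pow_succ]; congr 1; omega
      _ ≤ _ := mul_le_mul hpow hbk (norm_nonneg _) (hpos S le_rfl).le
  have hxb : x b * r = ‖b‖ := div_mul_cancel₀ _ hr.ne'
  rw [q_gnr h0 h1 hr.le, g1, ← hxb]
  have := (hl k hk1 hkn).trans hfin
  calc l * (r * gnr Q.divX r) ≤ ((S.map x).prod * x b) * (r * gnr Q.divX r) :=
        mul_le_mul_of_nonneg_right this (by positivity)
    _ = _ := by ring

end Aux2
section Aux3

lemma exists_rho {N : ℕ} (hN : 0 < N) (φ : ℕ → ℝ → ℝ) (R l η : ℕ → ℝ)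
    (hφc : ∀ i, Continuous (φ i)) (hφm : ∀ i, Monotone (φ i)) (hφ0 : ∀ i, φ i 0 = 0)
    (hφp : ∀ i, φ (i + N) = φ i) (hRp : ∀ i, R (i + N) = R i) (hlp : ∀ i, l (i + N) = l i)
    (hηp : ∀ i, η (i + N) = η i)
    (hR : ∀ i, 0 < R i) (hl : ∀ i, 0 < l i) (hη : ∀ i, 0 < η i)
    (hlin : ∀ i s, 0 ≤ s → s ≤ η i → φ i s ≤ l i * s)
    (hprod : ∏ i ∈ Finset.range N, l i < 1) :
    ∃ ρ : ℕ → ℝ, (∀ i, 0 < ρ i) ∧ (∀ i, ρ i ≤ R i) ∧ (∀ i, ρ (i + N) = ρ i) ∧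
      (∀ i, φ i (ρ i) ≤ ρ (i + 1)) ∧ (∀ i, φ i (ρ i) < ρ (i + 1) → ρ i = R i) := by
  set S : Set (ℕ → ℝ) := {t | ∀ i, 0 ≤ t i ∧ t i ≤ R i ∧ φ i (t i) ≤ t (i + 1)} with hS
  -- periodicity mod N
  have permod : ∀ f : ℕ → ℝ, (∀ i, f (i + N) = f i) → ∀ i, f (i % N) = f i := by
    intro f hf i
    exact (Function.Periodic.map_mod_nat (f := f) hf i)
  -- a positive element
  have hposel : ∃ t ∈ S, ∀ i, 0 < t i := by
    set M : ℕ → ℝ := fun i => ∏ j ∈ Finset.range i, l j with hM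
    have hMpos : ∀ i, 0 < M i := fun i => Finset.prod_pos (fun j _ => hl j)
    obtain ⟨ε, hε, hε2⟩ : ∃ ε > 0, ∀ i < N, ε * M i ≤ R i ∧ ε * M i ≤ η i := by
      have hne : (Finset.range N).Nonempty := ⟨0, Finset.mem_range.2 hN⟩
      obtain ⟨i0, -, hi0⟩ := Finset.exists_min_image (Finset.range N)
        (fun i => min (R i) (η i) / M i) hne
      refine ⟨min (R i0) (η i0) / M i0, div_pos (lt_min (hR _) (hη _)) (hMpos _), ?_⟩
      intro i hi
      have h := hi0 i (Finset.mem_range.2 hi)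
      rw [le_div_iff₀ (hMpos i)] at h
      exact ⟨h.trans (min_le_left _ _), h.trans (min_le_right _ _)⟩
    refine ⟨fun i => ε * M (i % N), ?_, fun i => mul_pos hε (hMpos _)⟩
    intro i
    have hi := Nat.mod_lt i hN
    have hφm' : φ (i % N) = φ i := Function.Periodic.map_mod_nat (f := φ) hφp i
    refine ⟨(mul_pos hε (hMpos _)).le, ?_, ?_⟩
    · rw [← permod R hRp i]; exact (hε2 _ hi).1
    · simp only
      rw [← hφm']
      refine (hlin _ _ (mul_pos hε (hMpos _)).le (hε2 _ hi).2).trans ?_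
      have e1 : l (i % N) * (ε * M (i % N)) = ε * M (i % N + 1) := by
        simp only [hM, Finset.prod_range_succ]; ring
      rw [e1]
      by_cases h : i % N + 1 = N
      · have e2 : (i + 1) % N = 0 := by
          rw [Nat.add_mod, ← Nat.add_mod, ← Nat.mod_add_mod, h, Nat.mod_self]
        rw [h, e2]
        have : M 0 = 1 := by simp [hM]
        rw [this]
        have : M N < 1 := hprod
        nlinarith
      · have e2 : (i + 1) % N = i % N + 1 := by
          rw [← Nat.mod_add_mod]; exact Nat.mod_eq_of_lt (by omega)
        rw [e2]
  obtain ⟨t0, ht0, ht0p⟩ := hposel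
  set ρ : ℕ → ℝ := fun i => sSup ((fun t : ℕ → ℝ => t i) '' S) with hρ
  have hbdd : ∀ i, BddAbove ((fun t : ℕ → ℝ => t i) '' S) := by
    intro i
    refine ⟨R i, ?_⟩
    rintro _ ⟨t, ht, rfl⟩
    exact (ht i).2.1
  have hne : ∀ i, ((fun t : ℕ → ℝ => t i) '' S).Nonempty := fun i => ⟨_, t0, ht0, rfl⟩
  have hle : ∀ t ∈ S, ∀ i, t i ≤ ρ i := fun t ht i => le_csSup (hbdd i) ⟨t, ht, rfl⟩
  have hpos : ∀ i, 0 < ρ i := fun i => (ht0p i).trans_le (hle t0 ht0 i)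
  have hρR : ∀ i, ρ i ≤ R i := by
    intro i
    apply csSup_le (hne i)
    rintro _ ⟨t, ht, rfl⟩
    exact (ht i).2.1
  have hρφ : ∀ i, φ i (ρ i) ≤ ρ (i + 1) := by
    intro i
    have : φ i (ρ i) = sSup (φ i '' ((fun t : ℕ → ℝ => t i) '' S)) :=
      (hφm i).map_csSup_of_continuousAt (hφc i).continuousAt (hne i) (hbdd i)
    rw [this]
    apply csSup_le ((hne i).image _)
    rintro _ ⟨_, ⟨t, ht, rfl⟩, rfl⟩
    exact (ht i).2.2.trans (hle t ht _)
  refine ⟨ρ, hpos, hρR, ?_, hρφ, ?_⟩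
  · intro i
    apply le_antisymm
    · apply csSup_le (hne _)
      rintro _ ⟨t, ht, rfl⟩
      refine hle (fun j => t (j + N)) ?_ i
      intro j
      have h := ht (j + N)
      rw [hRp, hφp] at h
      refine ⟨h.1, h.2.1, h.2.2.trans (le_of_eq ?_)⟩
      simp only; congr 1; omega
    · apply csSup_le (hne _)
      rintro _ ⟨t, ht, rfl⟩
      have h := hle (fun j => if j < N then 0 else t (j - N)) ?_ (i + N)
      · simpa using h
      · intro j
        simp only
        by_cases hj : j < N
        · rw [if_pos hj]
          refine ⟨le_rfl, (hR j).le, ?_⟩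
          rw [hφ0]
          split_ifs
          · exact le_rfl
          · exact (ht _).1
        · rw [if_neg hj, if_neg (by omega)]
          obtain ⟨m, rfl⟩ : ∃ m, j = m + N := ⟨j - N, by omega⟩
          have h := ht m
          rw [hRp, hφp]
          have e1 : m + N - N = m := by omega
          have e2 : m + N + 1 - N = m + 1 := by omega
          rw [e1, e2]
          exact h
  · intro i hi
    by_contra hne'
    have hlt : ρ i < R i := lt_of_le_of_ne (hρR i) hne'
    have hev : ∀ᶠ x in nhds (ρ i), φ i x < ρ (i + 1) :=
      (hφc i).continuousAt.eventually_lt continuousAt_const hi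
    have hev2 : ∀ᶠ x in nhds (ρ i), x < R i := eventually_lt_nhds hlt
    obtain ⟨x, hx, hx1, hx2⟩ : ∃ x, ρ i < x ∧ φ i x < ρ (i + 1) ∧ x < R i := by
      have h3 : ∀ᶠ x in nhdsWithin (ρ i) (Set.Ioi (ρ i)), ρ i < x ∧ φ i x < ρ (i + 1) ∧ x < R i := by
        filter_upwards [self_mem_nhdsWithin, nhdsWithin_le_nhds hev, nhdsWithin_le_nhds hev2] with x a b c
        exact ⟨a, b, c⟩
      exact h3.exists
    have h := hle (Function.update ρ i x) ?_ i
    · rw [Function.update_self] at h; linarith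
    · intro j
      by_cases hj : j = i
      · subst hj
        rw [Function.update_self, Function.update_of_ne (by omega)]
        exact ⟨(hpos j).le.trans hx.le, hx2.le, hx1.le⟩
      · rw [Function.update_of_ne hj]
        refine ⟨(hpos j).le, hρR j, (hρφ j).trans ?_⟩
        by_cases hj2 : j + 1 = i
        · rw [hj2, Function.update_self]; exact hx.le
        · rw [Function.update_of_ne hj2]

lemma real_conv {N : ℕ} (hN : 0 < N) (e κ : ℕ → ℝ) (i j0 : ℕ) (he : ∀ n, 0 ≤ e n)
    (hκ1 : ∀ n, κ n ≤ 1) (hκp : ∀ n, κ (n + N) = κ n)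
    (hj0 : κ j0 < 1) (hs : ∀ n, e (n + 1) ≤ κ (i + n) * e n) :
    Tendsto e atTop (nhds 0) := by
  have hanti : Antitone e := by
    apply antitone_nat_of_succ_le
    intro n
    have := hs n
    have h1 := mul_le_mul_of_nonneg_right (hκ1 (i + n)) (he n)
    linarith
  have hb : BddBelow (Set.range e) := ⟨0, by rintro _ ⟨n, rfl⟩; exact he n⟩
  have ht := tendsto_atTop_ciInf hanti hb
  set L := ⨅ n, e n
  have hL0 : 0 ≤ L := le_ciInf he
  have hmod : ∀ m, κ (m % N) = κ m := fun m => Function.Periodic.map_mod_nat (f := κ) hκp m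
  have hi : i ≤ N * i := Nat.le_mul_of_pos_left _ hN
  have hk : ∀ m, e (j0 + N * i - i + N * m + 1) ≤ κ j0 * e (j0 + N * i - i + N * m) := by
    intro m
    have := hs (j0 + N * i - i + N * m)
    have e1 : i + (j0 + N * i - i + N * m) = j0 + N * (i + m) := by
      rw [mul_add]; omega
    rw [e1, ← hmod, Nat.add_mul_mod_self_left, hmod] at this
    exact this
  have hsub : Tendsto (fun m => j0 + N * i - i + N * m) atTop atTop := by
    apply tendsto_atTop_mono (f := fun m => m) _ tendsto_id
    intro m
    have : m ≤ N * m := Nat.le_mul_of_pos_left _ hN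
    omega
  have h1 := ht.comp hsub
  have h2 := ht.comp ((tendsto_add_atTop_nat 1).comp hsub)
  have h3 : L ≤ κ j0 * L := le_of_tendsto_of_tendsto' h2 (h1.const_mul _) hk
  have : L = 0 := by nlinarith
  rwa [this] at ht

lemma telescope {N : ℕ} (l x ρ : ℕ → ℝ) (hρ : ∀ i, 0 < ρ i) (hper : ρ N = ρ 0)
    (hx : ∀ i, 0 ≤ x i) (h : ∀ i < N, x i * ρ (i + 1) ≤ l i * ρ i) :
    ∏ i ∈ Finset.range N, x i ≤ ∏ i ∈ Finset.range N, l i := by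
  have h1 : ∏ i ∈ Finset.range N, (x i * ρ (i + 1)) ≤ ∏ i ∈ Finset.range N, (l i * ρ i) := by
    apply Finset.prod_le_prod
    · intro i _; exact mul_nonneg (hx i) (hρ _).le
    · intro i hi; exact h i (Finset.mem_range.1 hi)
  rw [Finset.prod_mul_distrib, Finset.prod_mul_distrib] at h1
  have h2 : ∏ i ∈ Finset.range N, ρ (i + 1) = ∏ i ∈ Finset.range N, ρ i := by
    have a := Finset.prod_range_succ ρ N
    have b := Finset.prod_range_succ' ρ N
    rw [a, hper] at b
    exact (mul_right_cancel₀ (hρ 0).ne' b).symm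
  rw [h2] at h1
  exact le_of_mul_le_mul_right h1 (Finset.prod_pos (fun i _ => hρ i))

variable {K : Type*} [NontriviallyNormedField K]

lemma lam_le {d m : ℕ} (h1 : 1 ≤ m) (h2 : m ≤ d) : lam K d ≤ ‖(m : K)‖ :=
  ciInf_le (f := fun m : Finset.Icc 1 d => ‖((m : ℕ) : K)‖) (Set.finite_range _).bddBelow
    ⟨m, Finset.mem_Icc.2 ⟨h1, h2⟩⟩

lemma lamHat_le {d m : ℕ} (h1 : 1 ≤ m) (h2 : m ≤ d) : lamHat K d ≤ ‖(m : K)‖ ^ m :=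
  ciInf_le (f := fun m : Finset.Icc 1 d => ‖((m : ℕ) : K)‖ ^ (m : ℕ)) (Set.finite_range _).bddBelow
    ⟨m, Finset.mem_Icc.2 ⟨h1, h2⟩⟩

lemma lam_ex {d : ℕ} (hd : 1 ≤ d) : ∃ m : ℕ, 1 ≤ m ∧ m ≤ d ∧ lam K d = ‖(m : K)‖ := by
  have : Nonempty (Finset.Icc 1 d) := ⟨⟨1, Finset.mem_Icc.2 ⟨le_rfl, hd⟩⟩⟩
  obtain ⟨⟨m, hm⟩, h⟩ := exists_eq_ciInf_of_finite (f := fun m : Finset.Icc 1 d => ‖((m : ℕ) : K)‖)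
  exact ⟨m, (Finset.mem_Icc.1 hm).1, (Finset.mem_Icc.1 hm).2, h.symm⟩

lemma lamHat_ex {d : ℕ} (hd : 1 ≤ d) : ∃ m : ℕ, 1 ≤ m ∧ m ≤ d ∧ lamHat K d = ‖(m : K)‖ ^ m := by
  have : Nonempty (Finset.Icc 1 d) := ⟨⟨1, Finset.mem_Icc.2 ⟨le_rfl, hd⟩⟩⟩
  obtain ⟨⟨m, hm⟩, h⟩ := exists_eq_ciInf_of_finite
    (f := fun m : Finset.Icc 1 d => ‖((m : ℕ) : K)‖ ^ (m : ℕ))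
  exact ⟨m, (Finset.mem_Icc.1 hm).1, (Finset.mem_Icc.1 hm).2, h.symm⟩

lemma lam_le_one {d : ℕ} (hd : 1 ≤ d) : lam K d ≤ 1 := by
  simpa using lam_le (K := K) le_rfl hd

lemma lamHat_le_sq [IsUltrametricDist K] {d : ℕ} (hd : 1 ≤ d) : lamHat K d ≤ lam K d * lam K d := by
  obtain ⟨m, h1, h2, h3⟩ := lam_ex (K := K) hd
  rw [h3]
  rcases h1.eq_or_lt with rfl | h1'
  · simpa using lamHat_le (K := K) le_rfl hd
  · refine (lamHat_le (K := K) h1 h2).trans ?_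
    rw [← pow_two]
    exact pow_le_pow_of_le_one (norm_nonneg _) (IsUltrametricDist.norm_natCast_le_one K m) h1'

end Aux3
section Aux4

variable {K : Type*} [NontriviallyNormedField K]

/-- Dynamical data of a cycle. -/
structure Dyn (P : Polynomial K) (d N : ℕ) (z : ℕ → K) : Prop where
  hd : 2 ≤ d
  hdeg : P.natDegree = d
  hN : 0 < N
  step : ∀ i, P.eval (z i) = z (i + 1)
  per : ∀ i, z (i + N) = z i
  inj : ∀ i j, z i = z j → i % N = j % N
  hne : ∀ i, P.derivative.eval (z i) ≠ 0
  mnz : ∀ m : ℕ, 1 ≤ m → m ≤ d → (m : K) ≠ 0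

/-- local form of the polynomial at the cycle. -/
noncomputable def Qp (P : Polynomial K) (z : ℕ → K) (i : ℕ) : Polynomial K :=
  taylor (z i) P - C (z (i + 1))

lemma Qp_eval (P : Polynomial K) (z : ℕ → K) (i : ℕ) (w : K) :
    (Qp P z i).eval w = P.eval (w + z i) - z (i + 1) := by
  simp [Qp, taylor_eval]

lemma Qp_der (P : Polynomial K) (z : ℕ → K) (i : ℕ) (w : K) :
    (Qp P z i).derivative.eval w = P.derivative.eval (w + z i) := by
  simp [Qp, taylor_apply, derivative_comp]

lemma Qp_deg (P : Polynomial K) (z : ℕ → K) (i : ℕ) :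
    (Qp P z i).natDegree = P.natDegree := by
  rw [Qp, natDegree_sub_C, natDegree_taylor]

variable {P : Polynomial K} {d N : ℕ} {z : ℕ → K}

lemma Dyn.q0 (D : Dyn P d N z) (i : ℕ) : (Qp P z i).eval 0 = 0 := by
  rw [Qp_eval, zero_add, D.step, sub_self]

lemma Dyn.q1 (D : Dyn P d N z) (i : ℕ) : (Qp P z i).derivative.eval 0 ≠ 0 := by
  rw [Qp_der, zero_add]; exact D.hne i

lemma Dyn.qp (D : Dyn P d N z) (i : ℕ) : Qp P z (i + N) = Qp P z i := by
  have : i + N + 1 = i + 1 + N := by omega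
  rw [Qp, Qp, D.per, this, D.per]

lemma Dyn.crit_deg (D : Dyn P d N z) (i : ℕ) : d - 1 ≤ (Qp P z i).derivative.natDegree := by
  apply le_natDegree_of_ne_zero
  have hd := D.hd
  have e : d - 1 + 1 = d := by omega
  have hq : (Qp P z i).natDegree = d := by rw [Qp_deg, D.hdeg]
  rw [coeff_derivative]
  have h2 : ((d - 1 : ℕ) : K) + 1 = (d : K) := by exact_mod_cast congrArg (Nat.cast : ℕ → K) e
  rw [e, h2, ← hq]
  refine mul_ne_zero ?_ ?_
  · exact leadingCoeff_ne_zero.2 (q_ne (D.q1 i))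
  · rw [hq]; exact D.mnz d (by omega) le_rfl

lemma minroot [IsAlgClosed K] {N : ℕ} (A : ℕ → Polynomial K) (hp : ∀ i, A (i + N) = A i)
    (hdeg : ∀ i, 0 < (A i).natDegree) (h0 : ∀ i, (A i).eval 0 ≠ 0) :
    ∃ R : ℕ → ℝ, (∀ i, 0 < R i) ∧ (∀ i, R (i + N) = R i) ∧
      (∀ i b, (A i).eval b = 0 → R i ≤ ‖b‖) ∧ (∀ i, ∃ b, (A i).eval b = 0 ∧ ‖b‖ = R i) := by
  classical
  have hA : ∀ i, A i ≠ 0 := fun i h => by have := hdeg i; rw [h] at this; simp at this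
  have h : ∀ i, ∃ b, (A i).eval b = 0 ∧ ∀ b', (A i).eval b' = 0 → ‖b‖ ≤ ‖b'‖ := by
    intro i
    obtain ⟨x, hx⟩ := IsAlgClosed.exists_root (A i) (by
      intro h; have := hdeg i; rw [natDegree_eq_of_degree_eq_some h] at this; exact lt_irrefl _ this)
    obtain ⟨b, hb, hb'⟩ := Finset.exists_min_image (A i).roots.toFinset (fun b => ‖b‖)
      ⟨x, by rw [Multiset.mem_toFinset, mem_roots (hA i)]; exact hx⟩
    rw [Multiset.mem_toFinset, mem_roots (hA i)] at hb
    refine ⟨b, hb, fun b' h' => hb' b' ?_⟩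
    rw [Multiset.mem_toFinset, mem_roots (hA i)]; exact h'
  choose b hb hb' using h
  have hm : ∀ i, A (i % N) = A i := fun i => Function.Periodic.map_mod_nat (f := A) hp i
  refine ⟨fun i => ‖b (i % N)‖, ?_, ?_, ?_, ?_⟩
  · intro i
    rw [norm_pos_iff]; intro h
    have := hb (i % N)
    rw [h] at this; exact h0 _ this
  · intro i; simp
  · intro i c hc
    apply hb'; rw [hm]; exact hc
  · intro i
    refine ⟨b (i % N), ?_, rfl⟩
    rw [← hm]; exact hb _

lemma Dyn.exR [IsAlgClosed K] (D : Dyn P d N z) :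
    ∃ R : ℕ → ℝ, (∀ i, 0 < R i) ∧ (∀ i, R (i + N) = R i) ∧
      (∀ i b, (Qp P z i).eval b = 0 → b ≠ 0 → R i ≤ ‖b‖) ∧
      (∀ i, ∃ b, (Qp P z i).eval b = 0 ∧ b ≠ 0 ∧ ‖b‖ = R i) := by
  have hd := D.hd
  obtain ⟨R, h1, h2, h3, h4⟩ := minroot (N := N) (fun i => (Qp P z i).divX)
    (fun i => by rw [D.qp])
    (fun i => by rw [natDegree_divX_eq_natDegree_tsub_one, Qp_deg, D.hdeg]; omega)
    (fun i => by rw [← q_der (D.q0 i)]; exact D.q1 i)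
  refine ⟨R, h1, h2, ?_, ?_⟩
  · intro i b hb hb0
    apply h3
    rw [q_fac (D.q0 i), eval_mul, eval_X] at hb
    exact (mul_eq_zero.1 hb).resolve_right hb0
  · intro i
    obtain ⟨b, hb, hbR⟩ := h4 i
    refine ⟨b, ?_, ?_, hbR⟩
    · rw [q_fac (D.q0 i), eval_mul, hb, zero_mul]
    · rw [← norm_pos_iff, hbR]; exact h1 i

lemma Dyn.exC [IsAlgClosed K] (D : Dyn P d N z) :
    ∃ R : ℕ → ℝ, (∀ i, 0 < R i) ∧ (∀ i, R (i + N) = R i) ∧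
      (∀ i b, (Qp P z i).derivative.eval b = 0 → R i ≤ ‖b‖) ∧
      (∀ i, ∃ b, (Qp P z i).derivative.eval b = 0 ∧ ‖b‖ = R i) := by
  have hd := D.hd
  exact minroot (N := N) (fun i => (Qp P z i).derivative)
    (fun i => by rw [D.qp])
    (fun i => lt_of_lt_of_le (by omega) (D.crit_deg i))
    (fun i => D.q1 i)

lemma Dyn.one [IsAlgClosed K] [IsUltrametricDist K] (D : Dyn P d N z) {i : ℕ} {r s : ℝ}
    (h : gnr (Qp P z i) r ≤ s) {w : K} (hw : ‖w - z i‖ < r) :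
    ‖P.eval w - z (i + 1)‖ < s := by
  have e : P.eval w - z (i + 1) = (Qp P z i).eval (w - z i) := by
    rw [Qp_eval, sub_add_cancel]
  rw [e]
  exact ((eval_le_gnr _ _).trans_lt (q_gnr_strict (D.q0 i) (D.q1 i) (norm_nonneg _) hw)).trans_le h

lemma Dyn.stay [IsAlgClosed K] [IsUltrametricDist K] (D : Dyn P d N z) {ρ : ℕ → ℝ}
    (hφ : ∀ i, gnr (Qp P z i) (ρ i) ≤ ρ (i + 1)) {i : ℕ} {w : K} (hw : ‖w - z i‖ < ρ i) (n : ℕ) :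
    ‖(fun z => P.eval z)^[n] w - z (i + n)‖ < ρ (i + n) := by
  induction n with
  | zero => simpa using hw
  | succ n ih =>
    rw [Function.iterate_succ_apply']
    exact D.one (hφ _) ih

lemma Dyn.conv [IsAlgClosed K] [IsUltrametricDist K] (D : Dyn P d N z) {ρ : ℕ → ℝ}
    (hρ : ∀ i, 0 < ρ i) (hρp : ∀ i, ρ (i + N) = ρ i)
    (hφ : ∀ i, gnr (Qp P z i) (ρ i) ≤ ρ (i + 1)) {j0 : ℕ}
    (hj0 : gnr (Qp P z j0) (ρ j0) < ρ (j0 + 1)) {i : ℕ} {w : K} (hw : ‖w - z i‖ < ρ i) :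
    Tendsto (fun n => ‖(fun z => P.eval z)^[n] w - z (i + n)‖) atTop (nhds 0) := by
  have hp1 : ∀ n, ρ (n + N + 1) = ρ (n + 1) := fun n => by
    have : n + N + 1 = n + 1 + N := by omega
    rw [this, hρp]
  have h := real_conv D.hN (fun n => ‖(fun z => P.eval z)^[n] w - z (i + n)‖ / ρ (i + n))
    (fun j => gnr (Qp P z j) (ρ j) / ρ (j + 1)) i j0
    (fun n => div_nonneg (norm_nonneg _) (hρ _).le)
    (fun n => (div_le_one (hρ _)).2 (hφ n))
    (fun n => by simp only [D.qp, hρp, hp1])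
    ((div_lt_one (hρ _)).2 hj0) (by
      intro n
      have hs := D.stay hφ hw n
      set u := (fun z => P.eval z)^[n] w with hu
      have e : (fun z => P.eval z)^[n + 1] w - z (i + (n + 1)) = (Qp P z (i + n)).eval (u - z (i + n)) := by
        rw [Qp_eval, sub_add_cancel, Function.iterate_succ_apply']; rfl
      rw [e]
      have h1 := eval_le_gnr (Qp P z (i + n)) (u - z (i + n))
      have h2 := q_gnr_ratio (D.q0 (i + n)) (D.q1 (i + n)) (norm_nonneg _) hs.le
      have h3 := hρ (i + n)
      have h4 := hρ (i + n + 1)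
      have h5 : ‖eval (u - z (i + n)) (Qp P z (i + n))‖ ≤
          gnr (Qp P z (i + n)) (ρ (i + n)) * ‖u - z (i + n)‖ / ρ (i + n) := by
        rw [le_div_iff₀ h3]
        exact (mul_le_mul_of_nonneg_right h1 h3.le).trans h2
      calc _ ≤ gnr (Qp P z (i + n)) (ρ (i + n)) * ‖u - z (i + n)‖ / ρ (i + n) / ρ (i + (n + 1)) := by
            gcongr
        _ = _ := by
          have : i + (n + 1) = i + n + 1 := by omega
          rw [this]; ring)
  obtain ⟨B, hB⟩ : ∃ B : ℝ, ∀ i, ρ i ≤ B := by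
    obtain ⟨B, hB⟩ := ((Finset.range N).image ρ).bddAbove
    refine ⟨B, fun i => ?_⟩
    rw [← Function.Periodic.map_mod_nat (f := ρ) hρp i]
    exact hB (by simpa using ⟨i % N, Nat.mod_lt _ D.hN, rfl⟩)
  have h' := h.mul_const B
  rw [zero_mul] at h'
  refine squeeze_zero (fun n => norm_nonneg _) (fun n => ?_) h'
  rw [div_mul_eq_mul_div, le_div_iff₀ (hρ _)]
  exact mul_le_mul_of_nonneg_left (hB _) (norm_nonneg _)

lemma Dyn.conv' [IsAlgClosed K] [IsUltrametricDist K] (D : Dyn P d N z) {ρ : ℕ → ℝ}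
    (hρ : ∀ i, 0 < ρ i) (hρp : ∀ i, ρ (i + N) = ρ i)
    (hφ : ∀ i, gnr (Qp P z i) (ρ i) ≤ ρ (i + 1)) {j0 : ℕ}
    (hj0 : gnr (Qp P z j0) (ρ j0) < ρ (j0 + 1)) {i : ℕ} {w : K} {r : ℝ}
    (hr : gnr (Qp P z i) r ≤ ρ (i + 1)) (hw : ‖w - z i‖ < r) :
    Tendsto (fun n => ‖(fun z => P.eval z)^[n] w - z (i + n)‖) atTop (nhds 0) := by
  have h := D.conv hρ hρp hφ hj0 (D.one hr hw)
  rw [← tendsto_add_atTop_iff_nat 1]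
  refine h.congr (fun n => ?_)
  rw [Function.iterate_succ_apply]
  have : i + 1 + n = i + (n + 1) := by omega
  rw [this]

lemma Dyn.fibre [IsAlgClosed K] [IsUltrametricDist K] (D : Dyn P d N z) {τ : ℕ → ℝ}
    (hφ : ∀ i, gnr (Qp P z i) (τ i) ≤ τ (i + 1))
    (hτ : ∀ i b, (Qp P z i).eval b = 0 → b ≠ 0 → τ i ≤ ‖b‖) (n : ℕ) :
    ∀ (i : ℕ) (w : K), ‖w - z i‖ < τ i → (fun z => P.eval z)^[n] w = z (i + n) → w = z i := by
  induction n with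
  | zero => intro i w _ h; simpa using h
  | succ n ih =>
    intro i w hw h
    rw [Function.iterate_succ_apply] at h
    have h1 := ih (i + 1) (P.eval w) (D.one (hφ i) hw) (by
      have : i + 1 + n = i + (n + 1) := by omega
      rw [this]; exact h)
    by_contra hne
    have := hτ i (w - z i) (by rw [Qp_eval, sub_add_cancel, h1, sub_self]) (sub_ne_zero.2 hne)
    linarith

/-- Critical points attracted to the cycle are eventually mapped to the cycle. -/
def HC (P : Polynomial K) (z : ℕ → K) : Prop :=
  ∀ c, P.derivative.eval c = 0 → ∀ i : ℕ,
    Tendsto (fun n => ‖(fun z => P.eval z)^[n] c - z (i + n)‖) atTop (nhds 0) →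
    ∃ n, (fun z => P.eval z)^[n] c = z (i + n)

lemma Dyn.crit [IsAlgClosed K] [IsUltrametricDist K] (D : Dyn P d N z) (H : HC P z) {ρ τ : ℕ → ℝ}
    (hρ : ∀ i, 0 < ρ i) (hρp : ∀ i, ρ (i + N) = ρ i)
    (hφ : ∀ i, gnr (Qp P z i) (ρ i) ≤ ρ (i + 1)) {j0 : ℕ}
    (hj0 : gnr (Qp P z j0) (ρ j0) < ρ (j0 + 1))
    (hφτ : ∀ i, gnr (Qp P z i) (τ i) ≤ τ (i + 1)) (hτρ : ∀ i, τ i ≤ ρ i)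
    (hτ : ∀ i b, (Qp P z i).eval b = 0 → b ≠ 0 → τ i ≤ ‖b‖) {i : ℕ} {r : ℝ}
    (hr : gnr (Qp P z i) r ≤ τ (i + 1)) {c : K} (hc : (Qp P z i).derivative.eval c = 0)
    (hcr : ‖c‖ < r) : (Qp P z i).eval c = 0 := by
  rw [Qp_der] at hc
  have hw : ‖c + z i - z i‖ < r := by simpa using hcr
  obtain ⟨n, hn⟩ := H _ hc i (D.conv' hρ hρp hφ hj0 (hr.trans (hτρ _)) hw)
  have h2 : (fun z => P.eval z)^[n] (P.eval (c + z i)) = z (i + 1 + n) := by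
    have h3 : (fun z => P.eval z)^[n + 1] (c + z i) = z (i + n + 1) := by
      rw [Function.iterate_succ_apply', hn]; exact D.step _
    rw [Function.iterate_succ_apply] at h3
    have : i + 1 + n = i + n + 1 := by omega
    rw [this]; exact h3
  have := D.fibre hφτ hτ n (i + 1) _ (D.one hr hw) h2
  rw [Qp_eval, this, sub_self]

end Aux4
section Aux5

variable {K : Type*} [NontriviallyNormedField K]
variable {P : Polynomial K} {d N : ℕ} {z : ℕ → K}

lemma lam_nonneg' (d : ℕ) : 0 ≤ lam K d := Real.iInf_nonneg (fun _ => norm_nonneg _)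

lemma lamHat_nonneg' (d : ℕ) : 0 ≤ lamHat K d :=
  Real.iInf_nonneg (fun _ => pow_nonneg (norm_nonneg _) _)

lemma Dyn.scheme1 [IsAlgClosed K] [IsUltrametricDist K] (D : Dyn P d N z) (H : HC P z)
    (hpos : 0 < lamHat K d)
    (hΛ : ∏ i ∈ Finset.range N, ‖P.derivative.eval (z i)‖ < lamHat K d ^ N) : False := by
  have hd := D.hd
  have hl1 : lamHat K d ≤ 1 := by
    simpa using lamHat_le (K := K) (d := d) (m := 1) le_rfl (by omega)
  have hΛ1 : ∏ i ∈ Finset.range N, ‖P.derivative.eval (z i)‖ < 1 :=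
    hΛ.trans_le (pow_le_one₀ hpos.le hl1)
  obtain ⟨R, hR0, hRp, hRr, hRe⟩ := D.exR
  have hder : ∀ i, (Qp P z i).derivative.eval 0 = P.derivative.eval (z i) := fun i => by
    rw [Qp_der, zero_add]
  have hlin : ∀ i s, 0 ≤ s → s ≤ R i → gnr (Qp P z i) s = ‖P.derivative.eval (z i)‖ * s := by
    intro i s hs hsR
    rw [q_lin' (D.q0 i) (D.q1 i) hs (fun b hb hb0 => hsR.trans (hRr i b hb hb0)), hder]
  obtain ⟨ρ, hρ, hρR, hρp, hφ, hst⟩ := exists_rho D.hN (fun i => gnr (Qp P z i)) R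
    (fun i => ‖P.derivative.eval (z i)‖) R (fun i => gnr_cont _) (fun i => gnr_mono _)
    (fun i => q_gnr0 (D.q0 i) (D.q1 i)) (fun i => by simp only [D.qp]) hRp
    (fun i => by simp only [D.per]) hRp hR0 (fun i => norm_pos_iff.2 (D.hne i)) hR0
    (fun i s h1 h2 => (hlin i s h1 h2).le) hΛ1
  have hρN : ρ N = ρ 0 := by simpa using hρp 0
  obtain ⟨j0, hj0⟩ : ∃ j0, gnr (Qp P z j0) (ρ j0) < ρ (j0 + 1) := by
    by_contra hcon
    push Not at hcon
    have := telescope (N := N) (fun i => ‖P.derivative.eval (z i)‖) (fun _ => 1) ρ hρ hρN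
      (fun _ => zero_le_one) (fun i _ => by
        rw [one_mul, ← hlin i _ (hρ i).le (hρR i)]; exact hcon i)
    simp only [Finset.prod_const_one] at this
    linarith
  have key : ∀ i < N, lamHat K d * ρ (i + 1) ≤ ‖P.derivative.eval (z i)‖ * ρ i := by
    intro i _
    rcases (hφ i).lt_or_eq with hlt | heq
    · have hρi := hst i hlt
      obtain ⟨r, hr1, hr2⟩ := q_inv (D.q0 i) (D.q1 i) (hρ i).le hlt.le
      have hr3 : ρ i < r := by
        rcases hr1.lt_or_eq with h | h
        · exact h
        · rw [h, hr2] at hlt; exact absurd hlt (lt_irrefl _)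
      obtain ⟨b, hb, hb0, hbR⟩ := hRe i
      have := q_F (D.q0 i) (D.q1 i) (l := lamHat K d) ((hρ i).trans hr3)
        (fun m h1 h2 => D.mnz m h1 (by rwa [Qp_deg, D.hdeg] at h2))
        (fun m h1 h2 => lamHat_le h1 (by rwa [Qp_deg, D.hdeg] at h2))
        (fun c hc hcr => D.crit H hρ hρp hφ hj0 hφ (fun _ => le_rfl)
          (fun i b hb hb0 => (hρR i).trans (hRr i b hb hb0)) hr2.le hc hcr)
        hb hb0 (by rw [hbR, ← hρi]; exact hr3)
      rw [hr2, hder, hbR, ← hρi] at this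
      exact this
    · rw [← hlin i _ (hρ i).le (hρR i), heq]
      have := hρ (i + 1)
      nlinarith
  have := telescope (N := N) (fun i => ‖P.derivative.eval (z i)‖) (fun _ => lamHat K d) ρ hρ hρN
      (fun _ => hpos.le) key
  simp only [Finset.prod_const, Finset.card_range] at this
  linarith

lemma count_disj {α : Type*} (s : Multiset α) (p : ℕ → α → Prop) [∀ i, DecidablePred (p i)] (N : ℕ)
    (h : ∀ c ∈ s, ∀ i < N, ∀ j < N, p i c → p j c → i = j) :
    ∑ i ∈ Finset.range N, (s.filter (p i)).card ≤ s.card := by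
  induction s using Multiset.induction_on with
  | empty => simp
  | cons a s ih =>
    have ih' := ih (fun c hc => h c (Multiset.mem_cons_of_mem hc))
    have h1 : ∀ i, ((a ::ₘ s).filter (p i)).card = (if p i a then 1 else 0) + (s.filter (p i)).card := by
      intro i
      by_cases hi : p i a
      · rw [Multiset.filter_cons_of_pos _ hi, if_pos hi, Multiset.card_cons, add_comm]
      · rw [Multiset.filter_cons_of_neg _ hi, if_neg hi, zero_add]
    simp only [h1]
    rw [Finset.sum_add_distrib, Multiset.card_cons, add_comm]
    refine Nat.add_le_add ih' ?_
    rw [Finset.sum_ite, Finset.sum_const_zero, add_zero, ← Finset.card_eq_sum_ones]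
    apply Finset.card_le_one.2
    intro i hi j hj
    rw [Finset.mem_filter, Finset.mem_range] at hi hj
    exact h a (Multiset.mem_cons_self _ _) i hi.1 j hj.1 hi.2 hj.2

lemma Dyn.disj (D : Dyn P d N z) {c : K} {i j : ℕ} (hi : i < N) (hj : j < N)
    (h1 : Tendsto (fun n => ‖(fun z => P.eval z)^[n] c - z (i + n)‖) atTop (nhds 0))
    (h2 : Tendsto (fun n => ‖(fun z => P.eval z)^[n] c - z (j + n)‖) atTop (nhds 0)) : i = j := by
  have h3 := h1.add h2
  rw [add_zero] at h3
  have hz : ∀ i t, z (i + t * N) = z i := by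
    intro i t
    exact Function.Periodic.nat_mul (f := z) D.per t i
  have hsub : Tendsto (fun t : ℕ => t * N) atTop atTop := by
    apply tendsto_atTop_mono (f := fun m => m) _ tendsto_id
    intro m
    exact Nat.le_mul_of_pos_right _ D.hN
  have h4 := h3.comp hsub
  have h5 : ‖z i - z j‖ ≤ 0 := by
    refine ge_of_tendsto' h4 (fun t => ?_)
    simp only [Function.comp, hz]
    rw [add_comm, ← norm_neg ((fun z => P.eval z)^[t * N] c - z i)]
    refine le_trans (le_of_eq ?_) (norm_add_le _ _)
    congr 1; ring
  have h6 := D.inj i j (sub_eq_zero.1 (norm_le_zero_iff.1 h5))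
  rwa [Nat.mod_eq_of_lt hi, Nat.mod_eq_of_lt hj] at h6

lemma Dyn.scheme2 [IsAlgClosed K] [IsUltrametricDist K] (D : Dyn P d N z) (H : HC P z)
    (hpos : 0 < lamHat K d)
    (hΛ : (∏ i ∈ Finset.range N, ‖P.derivative.eval (z i)‖) * lam K d ^ (d - 1)
      < lam K d ^ N * lamHat K d ^ (d - 1)) : False := by
  classical
  have hd := D.hd
  have hlsq := lamHat_le_sq (K := K) (d := d) (by omega)
  have hl1 : lam K d ≤ 1 := lam_le_one (by omega)
  have hl0 : 0 < lam K d := by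
    rcases (lam_nonneg' (K := K) d).lt_or_eq with h | h
    · exact h
    · rw [← h] at hlsq; linarith
  obtain ⟨μ, hμ⟩ : ∃ μ, lamHat K d = lam K d * μ := ⟨lamHat K d / lam K d, by field_simp⟩
  have hμ0 : 0 < μ := by
    rw [hμ] at hpos; exact pos_of_mul_pos_right hpos hl0.le
  have hμl : μ ≤ lam K d := by
    rw [hμ] at hlsq; exact le_of_mul_le_mul_left hlsq hl0
  have hμ1 : μ ≤ 1 := hμl.trans hl1
  have hΛ' : ∏ i ∈ Finset.range N, ‖P.derivative.eval (z i)‖ < lam K d ^ N * μ ^ (d - 1) := by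
    rw [hμ, mul_pow, mul_comm (lam K d ^ (d - 1)), ← mul_assoc] at hΛ
    exact lt_of_mul_lt_mul_right hΛ (pow_nonneg hl0.le _)
  have hΛN : ∏ i ∈ Finset.range N, ‖P.derivative.eval (z i)‖ < lam K d ^ N :=
    hΛ'.trans_le (mul_le_of_le_one_right (pow_nonneg hl0.le _) (pow_le_one₀ hμ0.le hμ1))
  have hΛ1 : ∏ i ∈ Finset.range N, ‖P.derivative.eval (z i)‖ < 1 :=
    hΛN.trans_le (pow_le_one₀ hl0.le hl1)
  obtain ⟨η, hη0, hηp, hηr, -⟩ := D.exR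
  obtain ⟨R, hR0, hRp, hRr, hRe⟩ := D.exC
  have hder : ∀ i, (Qp P z i).derivative.eval 0 = P.derivative.eval (z i) := fun i => by
    rw [Qp_der, zero_add]
  have hlin : ∀ i s, 0 ≤ s → s ≤ η i → gnr (Qp P z i) s = ‖P.derivative.eval (z i)‖ * s := by
    intro i s hs hsR
    rw [q_lin' (D.q0 i) (D.q1 i) hs (fun b hb hb0 => hsR.trans (hηr i b hb hb0)), hder]
  obtain ⟨ρ, hρ, hρR, hρp, hφ, hst⟩ := exists_rho D.hN (fun i => gnr (Qp P z i)) R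
    (fun i => ‖P.derivative.eval (z i)‖) η (fun i => gnr_cont _) (fun i => gnr_mono _)
    (fun i => q_gnr0 (D.q0 i) (D.q1 i)) (fun i => by simp only [D.qp]) hRp
    (fun i => by simp only [D.per]) hηp hR0 (fun i => norm_pos_iff.2 (D.hne i)) hη0
    (fun i s h1 h2 => (hlin i s h1 h2).le) hΛ1
  have hρN : ρ N = ρ 0 := by simpa using hρp 0
  have hU : ∀ i r, 0 < r → r ≤ R i →
      lam K d * gnr (Qp P z i) r ≤ ‖P.derivative.eval (z i)‖ * r := by
    intro i r hr hrR
    have := q_U (D.q0 i) (D.q1 i) (l := lam K d) hr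
      (fun m h1 h2 => lam_le h1 (by rwa [Qp_deg, D.hdeg] at h2))
      (fun c hc => hrR.trans (hRr i c hc))
    rwa [hder] at this
  obtain ⟨j0, hj0⟩ : ∃ j0, gnr (Qp P z j0) (ρ j0) < ρ (j0 + 1) := by
    by_contra hcon
    push Not at hcon
    have := telescope (N := N) (fun i => ‖P.derivative.eval (z i)‖) (fun _ => lam K d) ρ hρ hρN
      (fun _ => hl0.le) (fun i _ =>
        (mul_le_mul_of_nonneg_left (hcon i) hl0.le).trans (hU i _ (hρ i) (hρR i)))
    simp only [Finset.prod_const, Finset.card_range] at this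
    linarith
  have hτφ : ∀ i, gnr (Qp P z i) (μ * ρ i) ≤ μ * ρ (i + 1) := by
    intro i
    have h := q_gnr_ratio (D.q0 i) (D.q1 i) (mul_nonneg hμ0.le (hρ i).le)
      (mul_le_of_le_one_left (hρ i).le hμ1)
    have h2 : gnr (Qp P z i) (μ * ρ i) ≤ μ * gnr (Qp P z i) (ρ i) := by
      refine le_of_mul_le_mul_right (h.trans (le_of_eq ?_)) (hρ i)
      ring
    exact h2.trans (mul_le_mul_of_nonneg_left (hφ i) hμ0.le)
  have hτρ : ∀ i, μ * ρ i ≤ ρ i := fun i => mul_le_of_le_one_left (hρ i).le hμ1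
  have hτr : ∀ i b, (Qp P z i).eval b = 0 → b ≠ 0 → μ * ρ i ≤ ‖b‖ := by
    intro i b hb hb0
    have := q_W (D.q0 i) (D.q1 i) (l := lam K d) (hρ i)
      (fun m h1 h2 => lam_le h1 (by rwa [Qp_deg, D.hdeg] at h2)) hl1
      (fun c hc => (hρR i).trans (hRr i c hc)) hb hb0
    exact (mul_le_mul_of_nonneg_right hμl (hρ i).le).trans this
  have hrex : ∀ i, ∃ r, ρ i ≤ r ∧ gnr (Qp P z i) r = ρ (i + 1) := fun i =>
    q_inv (D.q0 i) (D.q1 i) (hρ i).le (hφ i)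
  choose r hr1 hr2 using hrex
  set q : ℕ → ℕ := fun i => (P.derivative.roots.filter (fun c => ‖c - z i‖ < r i)).card with hq
  have hP0 : P.derivative ≠ 0 := by
    intro h
    have := D.hne 0
    rw [h] at this; simp at this
  have hqsum : ∑ i ∈ Finset.range N, q i ≤ d - 1 := by
    have h1 := count_disj P.derivative.roots (fun i c => ‖c - z i‖ < r i) N (by
      intro c _ i hi j hj h1 h2
      exact D.disj hi hj (D.conv' hρ hρp hφ hj0 (hr2 i).le h1) (D.conv' hρ hρp hφ hj0 (hr2 j).le h2))
    refine h1.trans ((card_roots' _).trans ?_)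
    have := natDegree_derivative_le P
    rwa [D.hdeg] at this
  have hF : ∀ i r b, 0 < r → (∀ c, (Qp P z i).derivative.eval c = 0 → ‖c‖ < r → (Qp P z i).eval c = 0) →
      (Qp P z i).eval b = 0 → b ≠ 0 → ‖b‖ < r →
      lamHat K d * gnr (Qp P z i) r ≤ ‖P.derivative.eval (z i)‖ * ‖b‖ := by
    intro i r b hr hc hb hb0 hbr
    have := q_F (D.q0 i) (D.q1 i) (l := lamHat K d) hr
        (fun m h1 h2 => D.mnz m h1 (by rwa [Qp_deg, D.hdeg] at h2))
        (fun m h1 h2 => lamHat_le h1 (by rwa [Qp_deg, D.hdeg] at h2)) hc hb hb0 hbr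
    rwa [hder] at this
  have key : ∀ i < N, lam K d * μ ^ (q i) * ρ (i + 1) ≤ ‖P.derivative.eval (z i)‖ * ρ i := by
    intro i _
    have hρ1 := hρ (i + 1)
    rcases (hφ i).lt_or_eq with hlt | heq
    · have hρi := hst i hlt
      have hr3 : ρ i < r i := by
        rcases (hr1 i).lt_or_eq with h | h
        · exact h
        · rw [h, hr2] at hlt; exact absurd hlt (lt_irrefl _)
      obtain ⟨c, hc, hcR⟩ := hRe i
      have hcn : c ≠ 0 := by
        rw [← norm_pos_iff, hcR]; exact hR0 i
      have hmem : ∀ c, (Qp P z i).derivative.eval c = 0 → ‖c‖ < r i →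
          c + z i ∈ P.derivative.roots.filter (fun c => ‖c - z i‖ < r i) := by
        intro c hc hcr
        rw [Multiset.mem_filter, mem_roots hP0]
        refine ⟨?_, by simpa using hcr⟩
        rw [Qp_der] at hc; exact hc
      have hcr : ‖c‖ < r i := by rw [hcR, ← hρi]; exact hr3
      have hq1 : 1 ≤ q i := Multiset.card_pos_iff_exists_mem.2 ⟨_, hmem c hc hcr⟩
      obtain ⟨r', hr'0, hr'⟩ := q_inv (D.q0 i) (D.q1 i) le_rfl (y := μ * ρ (i + 1)) (by
        rw [q_gnr0 (D.q0 i) (D.q1 i)]; positivity)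
      have hr'p : 0 < r' := by
        rcases hr'0.lt_or_eq with h | h
        · exact h
        · rw [← h, q_gnr0 (D.q0 i) (D.q1 i)] at hr'
          have := mul_pos hμ0 hρ1
          linarith
      rcases le_or_gt r' (R i) with hle | hgt
      · have h1 := hU i r' hr'p hle
        rw [hr'] at h1
        have h2 : μ ^ (q i) ≤ μ := by
          simpa using pow_le_pow_of_le_one hμ0.le hμ1 hq1
        calc lam K d * μ ^ (q i) * ρ (i + 1) ≤ lam K d * μ * ρ (i + 1) := by gcongr
          _ = lam K d * (μ * ρ (i + 1)) := by ring
          _ ≤ _ := h1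
          _ ≤ _ := by rw [hρi]; gcongr
      · have hall : ∀ c, (Qp P z i).derivative.eval c = 0 → ‖c‖ < r' → (Qp P z i).eval c = 0 :=
          fun c hc hcr => D.crit H (τ := fun i => μ * ρ i) hρ hρp hφ hj0 hτφ hτρ hτr hr'.le hc hcr
        have hQc := hall c hc (by rw [hcR]; exact hgt)
        rcases hq1.lt_or_eq with hq2 | hq2
        · have h1 := hF i r' c hr'p hall hQc hcn (by rw [hcR]; exact hgt)
          rw [hr', hcR, hμ] at h1
          have h2 : μ ^ (q i) ≤ μ ^ 2 := pow_le_pow_of_le_one hμ0.le hμ1 hq2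
          calc lam K d * μ ^ (q i) * ρ (i + 1) ≤ lam K d * μ ^ 2 * ρ (i + 1) := by gcongr
            _ = lam K d * μ * (μ * ρ (i + 1)) := by ring
            _ ≤ _ := h1
            _ = _ := by rw [hρi]
        · have h1 := hF i (r i) c ((hρ i).trans hr3) (by
            intro c' hc' hcr'
            obtain ⟨a, ha⟩ := Multiset.card_eq_one.1 hq2.symm
            have m1 := hmem c hc hcr
            have m2 := hmem c' hc' hcr'
            rw [ha, Multiset.mem_singleton] at m1 m2
            have : c' = c := add_right_cancel (m2.trans m1.symm)
            rw [this]; exact hQc) hQc hcn hcr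
          rw [hr2, hcR, hμ, ← hρi] at h1
          rw [← hq2, pow_one]; exact h1
    · have h1 := hU i _ (hρ i) (hρR i)
      rw [heq] at h1
      refine le_trans ?_ h1
      have : μ ^ (q i) ≤ 1 := pow_le_one₀ hμ0.le hμ1
      calc lam K d * μ ^ (q i) * ρ (i + 1) ≤ lam K d * 1 * ρ (i + 1) := by gcongr
        _ = _ := by ring
  have h1 := telescope (N := N) (fun i => ‖P.derivative.eval (z i)‖)
      (fun i => lam K d * μ ^ (q i)) ρ hρ hρN (fun i => by positivity) key
  rw [Finset.prod_mul_distrib, Finset.prod_const, Finset.card_range, Finset.prod_pow_eq_pow_sum] at h1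
  have h2 : μ ^ (d - 1) ≤ μ ^ (∑ i ∈ Finset.range N, q i) := pow_le_pow_of_le_one hμ0.le hμ1 hqsum
  have h3 := mul_le_mul_of_nonneg_left h2 (pow_nonneg hl0.le N)
  linarith

end Aux5

theorem infinite_orbit_critical_point_attracted_polynomial
    {K : Type*} [NontriviallyNormedField K] [IsAlgClosed K]
    [CompleteSpace K] [IsUltrametricDist K]
    (P : Polynomial K) (d : ℕ) (hd : 2 ≤ d) (hdeg : P.natDegree = d)
    (z0 : K) (N : ℕ) (hN : 0 < N)
    (hper : (fun z => P.eval z)^[N] z0 = z0)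
    (hmin : ∀ m : ℕ, 0 < m → m < N → (fun z => P.eval z)^[m] z0 ≠ z0)
    (hne : (∏ i ∈ Finset.range N, P.derivative.eval ((fun z => P.eval z)^[i] z0)) ≠ 0)
    (hlt :
      (N ≤ d - 1 ∧
        ‖∏ i ∈ Finset.range N, P.derivative.eval ((fun z => P.eval z)^[i] z0)‖ <
          lamHat K d ^ N) ∨
      (d - 1 < N ∧
        ‖∏ i ∈ Finset.range N, P.derivative.eval ((fun z => P.eval z)^[i] z0)‖ *
            lam K d ^ (d - 1) <
          lam K d ^ N * lamHat K d ^ (d - 1))) :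
    ∃ c : K, P.derivative.eval c = 0 ∧
      Function.Injective (fun n : ℕ => (fun z => P.eval z)^[n] c) ∧
      ∃ i < N,
        Tendsto (fun n => (fun z => P.eval z)^[n * N] c) atTop
          (nhds ((fun z => P.eval z)^[i] z0)) := by
  by_contra hgoal
  set z : ℕ → K := fun i => (fun z => P.eval z)^[i] z0 with hz
  have hpp : Function.IsPeriodicPt (fun z => P.eval z) N z0 := hper
  have hmp : Function.minimalPeriod (fun z => P.eval z) z0 = N := by
    apply le_antisymm (hpp.minimalPeriod_le hN)
    by_contra hlt'
    push Not at hlt'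
    exact hmin _ (hpp.minimalPeriod_pos hN) hlt' (Function.iterate_minimalPeriod)
  have hperz : ∀ i, z (i + N) = z i := by
    intro i
    simp only [hz]
    rw [Function.iterate_add_apply, hper]
  have hmodz : ∀ i, z (i % N) = z i := fun i => Function.Periodic.map_mod_nat (f := z) hperz i
  have hlpos : 0 < lamHat K d := by
    rcases (lamHat_nonneg' (K := K) d).lt_or_eq with h | h
    · exact h
    · exfalso
      rw [← h] at hlt
      rw [zero_pow hN.ne', zero_pow (by omega), mul_zero] at hlt
      rcases hlt with ⟨-, h⟩ | ⟨-, h⟩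
      · exact absurd h (not_lt.2 (norm_nonneg _))
      · exact absurd h (not_lt.2 (mul_nonneg (norm_nonneg _) (pow_nonneg (lam_nonneg' d) _)))
  have D : Dyn P d N z := by
    refine ⟨hd, hdeg, hN, ?_, hperz, ?_, ?_, ?_⟩
    · intro i
      simp only [hz]
      rw [Function.iterate_succ_apply']
    · intro i j hij
      rw [← hmodz i, ← hmodz j] at hij
      refine (Function.iterate_eq_iterate_iff_of_lt_minimalPeriod ?_ ?_).1 hij
      · rw [hmp]; exact Nat.mod_lt _ hN
      · rw [hmp]; exact Nat.mod_lt _ hN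
    · intro i
      rw [← hmodz]
      exact Finset.prod_ne_zero_iff.1 hne _ (Finset.mem_range.2 (Nat.mod_lt _ hN))
    · intro m h1 h2 h3
      have := lamHat_le (K := K) h1 h2
      rw [h3, norm_zero, zero_pow (by omega)] at this
      linarith
  have hzN : ∀ i t, z (i + t * N) = z i := fun i t =>
    Function.Periodic.nat_mul (f := z) hperz t i
  have H : HC P z := by
    intro c hc i ht
    by_cases hinj : Function.Injective (fun n : ℕ => (fun z => P.eval z)^[n] c)
    · exfalso
      refine hgoal ⟨c, hc, hinj, i % N, Nat.mod_lt _ hN, ?_⟩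
      rw [tendsto_iff_norm_sub_tendsto_zero]
      have hsub : Tendsto (fun t : ℕ => t * N) atTop atTop :=
        tendsto_atTop_mono (f := fun m => m) (fun m => Nat.le_mul_of_pos_right _ hN) tendsto_id
      refine (ht.comp hsub).congr (fun n => ?_)
      simp only [Function.comp]
      rw [hzN, ← hmodz i]
    · obtain ⟨a, b, hab, hf⟩ : ∃ a b : ℕ, a < b ∧
          (fun z => P.eval z)^[a] c = (fun z => P.eval z)^[b] c := by
        simp only [Function.Injective, not_forall] at hinj
        obtain ⟨a, b, h1, h2⟩ := hinj
        rcases lt_or_gt_of_ne h2 with h | h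
        · exact ⟨a, b, h, h1⟩
        · exact ⟨b, a, h, h1.symm⟩
      refine ⟨a, ?_⟩
      have hiter : ∀ t, (fun z => P.eval z)^[a + t * (b - a)] c = (fun z => P.eval z)^[a] c := by
        intro t
        induction t with
        | zero => simp
        | succ t ih =>
          have e : a + (t + 1) * (b - a) = t * (b - a) + b := by
            rw [add_mul, one_mul]; omega
          rw [e, Function.iterate_add_apply, ← hf, ← Function.iterate_add_apply, add_comm, ih]
      have hsub : Tendsto (fun t : ℕ => a + (t * N) * (b - a)) atTop atTop := by
        refine tendsto_atTop_mono (f := fun m => m) (fun m => ?_) tendsto_id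
        have h1 : m ≤ m * N := Nat.le_mul_of_pos_right _ hN
        have h2 : m * N ≤ m * N * (b - a) := Nat.le_mul_of_pos_right _ (by omega)
        omega
      have h3 := ht.comp hsub
      have h4 : ∀ t : ℕ, ((fun n => ‖(fun z => P.eval z)^[n] c - z (i + n)‖) ∘
          (fun t : ℕ => a + (t * N) * (b - a))) t = ‖(fun z => P.eval z)^[a] c - z (i + a)‖ := by
        intro t
        simp only [Function.comp]
        rw [hiter]
        have e : i + (a + t * N * (b - a)) = i + a + (t * (b - a)) * N := by ring
        rw [e, hzN]
      have h5 := tendsto_nhds_unique (h3.congr h4) tendsto_const_nhds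
      exact sub_eq_zero.1 (norm_eq_zero.1 h5.symm)
  rw [norm_prod] at hlt
  rcases hlt with ⟨-, h⟩ | ⟨-, h⟩
  · exact D.scheme1 H hlpos h
  · exact D.scheme2 H hlpos h
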